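/- Mixing with the completely mixed state produces way-below approximants: let ρ be a density matrix on M_n(ℂ), let 0 < t ≤ 1, and set ρ(t) = (1−t)•ρ + t•⊥ₙ where ⊥ₙ = (1/n)•Iₙ. Then for every sequence (σⱼ) of density matrices that is increasing in the QPE order (σⱼ ⊑ σⱼ₊₁ for all j) and converges in operator norm to a density matrix σ with ρ ⊑ σ, there exists an index j with ρ(t) ⊑ σⱼ. -/

import Mathlib

open Matrix
open scoped ComplexOrder

/-- The largest eigenvalue of a matrix (for a positive semidefinite matrix this
equals the operator norm). -/
noncomputable def maxEig {m : Type*} [Fintype m] (A : Matrix m m ℂ) : ℝ :=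
  sSup {a : ℝ | ∃ v : m → ℂ, v ≠ 0 ∧ A.mulVec v = (a : ℂ) • v}

/-- A density matrix: positive semidefinite with trace 1. -/
def IsDensity {m : Type*} [Fintype m] (ρ : Matrix m m ℂ) : Prop :=
  ρ.PosSemidef ∧ ρ.trace = 1

/-- The quantum positive evidence (QPE) order: ρ ⊑ σ iff σ⁺•ρ - ρ⁺•σ ≥ 0. -/
def QPE {m : Type*} [Fintype m] (ρ σ : Matrix m m ℂ) : Prop :=
  (maxEig σ • ρ - maxEig ρ • σ).PosSemidef

section

open scoped Matrix.Norms.L2Operator MatrixOrder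

/-- On positive semidefinite matrices, the largest eigenvalue is the operator norm. -/
theorem maxEig_eq_norm {m : Type*} [Fintype m] [DecidableEq m] [Nonempty m]
    {A : Matrix m m ℂ} (hA : 0 ≤ A) : maxEig A = ‖A‖ := by
  have key : ∀ a : ℝ, (∃ v : m → ℂ, v ≠ 0 ∧ A.mulVec v = (a : ℂ) • v) ↔
      (a : ℂ) ∈ spectrum ℂ A := by
    intro a
    rw [← Matrix.spectrum_toLin', ← Module.End.hasEigenvalue_iff_mem_spectrum]
    constructor
    · rintro ⟨v, hv, h⟩
      exact Module.End.hasEigenvalue_of_hasEigenvector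
        ⟨Module.End.mem_eigenspace_iff.2 (by simpa using h), hv⟩
    · intro h
      obtain ⟨v, hv⟩ := h.exists_hasEigenvector
      exact ⟨v, hv.2, by simpa using hv.apply_eq_smul⟩
  have hset : {a : ℝ | ∃ v : m → ℂ, v ≠ 0 ∧ A.mulVec v = (a : ℂ) • v} =
      {a : ℝ | (a : ℂ) ∈ spectrum ℂ A} := Set.ext key
  unfold maxEig
  rw [hset]
  refine IsGreatest.csSup_eq ⟨?_, ?_⟩
  · exact spectrum.algebraMap_mem ℂ (CStarAlgebra.norm_mem_spectrum_of_nonneg hA)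
  · intro a ha
    exact (le_abs_self a).trans (spectrum.norm_le_norm_of_mem ha)

/-- If `X ≥ 0` has finite spectrum, then every `D` with `0 ≤ D ≤ X` is dominated by a multiple
of `X` proportional to the norm of `D`. -/
theorem exists_forall_le_norm_smul_of_le {A : Type*} [CStarAlgebra A] [PartialOrder A]
    [StarOrderedRing A] {X : A} (hX : 0 ≤ X) (hfin : (spectrum ℝ X).Finite) :
    ∃ C : ℝ, ∀ D : A, 0 ≤ D → D ≤ X → D ≤ (‖D‖ * C) • X := by
  have hsa : IsSelfAdjoint X := IsSelfAdjoint.of_nonneg hX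
  have hcont (f : ℝ → ℝ) : ContinuousOn f (spectrum ℝ X) := hfin.continuousOn f
  set f : ℝ → ℝ := fun x => if x = 0 then 0 else 1 with hf
  set P : A := cfc f X with hP
  have hPsa : IsSelfAdjoint P := cfc_predicate f X
  have hPP : P * P = P := by
    rw [hP, ← cfc_mul f f X (hcont _) (hcont _)]
    congr 1
    ext x
    by_cases hx : x = 0 <;> simp [hf, hx]
  have hXP : X * P = X := by
    have h := cfc_mul id f X (hcont _) (hcont _)
    have hid : (fun x => id x * f x) = id := by
      ext x
      by_cases hx : x = 0 <;> simp [hf, hx]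
    rwa [hid, cfc_id ℝ X, eq_comm] at h
  obtain ⟨C, hC⟩ : ∃ C : ℝ, P ≤ C • X := by
    obtain ⟨C, hC⟩ := (hfin.image fun x : ℝ => x⁻¹).bddAbove
    refine ⟨C, ?_⟩
    rw [← cfc_const_mul_id C X]
    refine cfc_mono (fun x hx => ?_) (hcont _) (hcont _)
    have hx0 : 0 ≤ x := spectrum_nonneg_of_nonneg hX hx
    rcases hx0.eq_or_lt with rfl | hpos
    · simp [hf]
    · have := hC ⟨x, hx, rfl⟩
      simp only [hf, hpos.ne', if_false]
      calc (1 : ℝ) = x⁻¹ * x := (inv_mul_cancel₀ hpos.ne').symm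
        _ ≤ C * x := by gcongr
  refine ⟨C, fun D hD hDX => ?_⟩
  have hQsa : star (1 - P) = 1 - P := by rw [star_sub, star_one, hPsa.star_eq]
  obtain ⟨b, rfl⟩ := CStarAlgebra.nonneg_iff_eq_star_mul_self.1 hD
  have hb : b * (1 - P) = 0 := by
    rw [← CStarRing.star_mul_self_eq_zero_iff]
    refine le_antisymm ?_ (star_mul_self_nonneg _)
    have h := star_left_conjugate_le_conjugate hDX (1 - P)
    rw [mul_assoc _ X, mul_sub X, hXP] at h
    simpa [mul_assoc] using h
  have hbP : b * P = b := by rw [mul_sub, mul_one, sub_eq_zero] at hb; exact hb.symm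
  have hPb : P * star b = star b := by
    simpa [hPsa.star_eq] using congrArg star hbP
  set D := star b * b with hDdef
  have hDP : P * D * P = D := by
    rw [hDdef, ← mul_assoc, hPb, mul_assoc, hbP]
  have h := star_left_conjugate_le_conjugate
    (IsSelfAdjoint.le_algebraMap_norm_self (IsSelfAdjoint.of_nonneg hD)) P
  rw [hPsa.star_eq, hDP, Algebra.algebraMap_eq_smul_one, mul_smul_comm, mul_one,
    smul_mul_assoc, hPP] at h
  rw [mul_smul]
  exact h.trans (smul_le_smul_of_nonneg_left hC (norm_nonneg D))

end

theorem stmt13 {n : ℕ} (ρ : Matrix (Fin n) (Fin n) ℂ) (hρ : IsDensity ρ)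
    (t : ℝ) (ht0 : 0 < t) (ht1 : t ≤ 1)
    (σseq : ℕ → Matrix (Fin n) (Fin n) ℂ) (hd : ∀ j, IsDensity (σseq j))
    (hmono : ∀ j, QPE (σseq j) (σseq (j + 1)))
    (σ : Matrix (Fin n) (Fin n) ℂ) (hσ : IsDensity σ)
    (hconv : Filter.Tendsto σseq Filter.atTop (nhds σ))
    (h : QPE ρ σ) :
    ∃ j, QPE ((1 - t) • ρ + t • ((n : ℝ)⁻¹ • (1 : Matrix (Fin n) (Fin n) ℂ))) (σseq j) := by
  open scoped Matrix.Norms.L2Operator MatrixOrder in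
  have hn : n ≠ 0 := by
    rintro rfl
    simpa [Matrix.trace] using hρ.2
  have : NeZero n := ⟨hn⟩
  have hn0 : (0 : ℝ) < (n : ℝ)⁻¹ := by positivity
  have nonneg {τ : Matrix (Fin n) (Fin n) ℂ} (hτ : IsDensity τ) : 0 ≤ τ := hτ.1.nonneg
  have norm_pos {τ : Matrix (Fin n) (Fin n) ℂ} (hτ : IsDensity τ) : 0 < ‖τ‖ := by
    refine norm_pos_iff.2 ?_
    rintro rfl
    simpa using hτ.2
  have qpe_iff {α β : Matrix (Fin n) (Fin n) ℂ} (hα : 0 ≤ α) (hβ : 0 ≤ β) :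
      QPE α β ↔ ‖α‖ • β ≤ ‖β‖ • α := by
    rw [QPE, maxEig_eq_norm hα, maxEig_eq_norm hβ, Matrix.le_iff]
  set s : ℕ → Matrix (Fin n) (Fin n) ℂ := fun j => ‖σseq j‖⁻¹ • σseq j with hs
  set S : Matrix (Fin n) (Fin n) ℂ := ‖σ‖⁻¹ • σ
  have hanti : Antitone s := antitone_nat_of_succ_le fun j => by
    have h1 := (qpe_iff (nonneg (hd j)) (nonneg (hd (j + 1)))).1 (hmono j)
    have p1 := norm_pos (hd j)
    have p2 := norm_pos (hd (j + 1))
    have h2 := smul_le_smul_of_nonneg_left h1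
      (show 0 ≤ ‖σseq j‖⁻¹ * ‖σseq (j + 1)‖⁻¹ by positivity)
    rw [smul_smul, smul_smul] at h2
    convert h2 using 2 <;> field_simp
  have hlim : Filter.Tendsto s Filter.atTop (nhds S) :=
    (hconv.norm.inv₀ (norm_pos hσ).ne').smul hconv
  have le_norm {τ : Matrix (Fin n) (Fin n) ℂ} (hτ : IsDensity τ) : ‖τ‖⁻¹ • τ ≤ 1 := by
    have h1 := smul_le_smul_of_nonneg_left
      (IsSelfAdjoint.le_algebraMap_norm_self (IsSelfAdjoint.of_nonneg (nonneg hτ)))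
      (inv_nonneg.2 (norm_nonneg τ))
    rwa [Algebra.algebraMap_eq_smul_one, smul_smul, inv_mul_cancel₀ (norm_pos hτ).ne',
      one_smul] at h1
  have hSs (j : ℕ) : S ≤ s j := hanti.le_of_tendsto hlim j
  obtain ⟨C, hC⟩ := exists_forall_le_norm_smul_of_le (sub_nonneg.2 (le_norm hσ))
    Matrix.finite_real_spectrum
  set R : ℝ := (1 - t) * ‖ρ‖ + t * (n : ℝ)⁻¹ with hR
  have ht1' : 0 ≤ 1 - t := sub_nonneg.2 ht1
  have hR0 : 0 < R := by positivity
  have hsmall : Filter.Tendsto (fun j => R * (‖s j - S‖ * C)) Filter.atTop (nhds 0) := by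
    have h1 := ((hlim.sub_const S).norm.mul_const C).const_mul R
    simpa using h1
  obtain ⟨j, hj⟩ := (hsmall.eventually_lt_const (show 0 < t * (n : ℝ)⁻¹ by positivity)).exists
  refine ⟨j, ?_⟩
  have hρ0 := nonneg hρ
  have hone : (0 : Matrix (Fin n) (Fin n) ℂ) ≤ 1 := zero_le_one
  have hmix : 0 ≤ (1 - t) • ρ + t • ((n : ℝ)⁻¹ • (1 : Matrix (Fin n) (Fin n) ℂ)) :=
    add_nonneg (smul_nonneg ht1' hρ0) (smul_nonneg ht0.le (smul_nonneg hn0.le hone))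
  have hmixR : ‖(1 - t) • ρ + t • ((n : ℝ)⁻¹ • (1 : Matrix (Fin n) (Fin n) ℂ))‖ ≤ R := by
    refine (norm_add_le _ _).trans ?_
    rw [norm_smul, norm_smul, norm_smul, norm_one, Real.norm_of_nonneg ht1',
      Real.norm_of_nonneg ht0.le, Real.norm_of_nonneg hn0.le, mul_one]
  rw [qpe_iff hmix (nonneg (hd j))]
  refine (smul_le_smul_of_nonneg_right hmixR (nonneg (hd j))).trans ?_
  have hρS : ‖ρ‖ • S ≤ ρ := by
    have h1 := smul_le_smul_of_nonneg_left ((qpe_iff hρ0 (nonneg hσ)).1 h)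
      (inv_nonneg.2 (norm_nonneg σ))
    rwa [smul_smul ‖σ‖⁻¹ ‖σ‖, inv_mul_cancel₀ (norm_pos hσ).ne', one_smul, smul_comm] at h1
  have hD := smul_le_smul_of_nonneg_left
    (hC (s j - S) (sub_nonneg.2 (hSs j)) (sub_le_sub_right (le_norm (hd j)) S)) hR0.le
  rw [smul_smul] at hD
  have hX := smul_le_smul_of_nonneg_right hj.le (sub_nonneg.2 (le_norm hσ))
  have hmain : R • s j ≤ (1 - t) • ρ + t • ((n : ℝ)⁻¹ • (1 : Matrix (Fin n) (Fin n) ℂ)) :=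
    calc R • s j = R • (s j - S) + R • S := by rw [smul_sub, sub_add_cancel]
      _ ≤ (t * (n : ℝ)⁻¹) • (1 - S) + R • S := by gcongr; exact hD.trans hX
      _ = (1 - t) • (‖ρ‖ • S) + t • ((n : ℝ)⁻¹ • (1 : Matrix (Fin n) (Fin n) ℂ)) := by
        rw [hR]; module
      _ ≤ _ := by gcongr
  have hfinal := smul_le_smul_of_nonneg_left hmain (norm_nonneg (σseq j))
  have heq : ‖σseq j‖ • R • s j = R • σseq j := by
    rw [smul_comm, hs]
    simp only [smul_smul]
    rw [mul_inv_cancel₀ (norm_pos (hd j)).ne', mul_one]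
  rwa [heq] at hfinal
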